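/- Let d ∈ ℕ and s, t ∈ ℕ be such that max(s, t) ≤ d ≤ s + t. Then the multinomial coefficient C^d_{d−s,d−t} = d!/((d−s)!·(d−t)!·(s+t−d)!) is odd if and only if d = s ∨ t, where s ∨ t is the bitwise or of the binary representations of s and t. -/

import Mathlib

theorem Nat.and_eq_zero_iff_mod_two_and_div_two (a b : ℕ) :
    a &&& b = 0 ↔ ¬(a % 2 = 1 ∧ b % 2 = 1) ∧ a / 2 &&& b / 2 = 0 := by
  rw [← Nat.and_mod_two_eq_one, ← Nat.and_div_two]
  omega

theorem Nat.odd_choose_add_iff_and_eq_zero (a b : ℕ) :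
    Odd ((a + b).choose a) ↔ a &&& b = 0 := by
  induction a using Nat.strong_induction_on generalizing b with
  | _ a ih =>
    rcases Nat.eq_zero_or_pos a with rfl | ha
    · simp
    have ih' := ih (a / 2) (by omega) (b / 2)
    have lucas : (a + b).choose a ≡
        ((a + b) % 2).choose (a % 2) * ((a + b) / 2).choose (a / 2) [MOD 2] :=
      Choose.choose_modEq_choose_mod_mul_choose_div_nat
    rw [Nat.odd_iff, lucas, ← Nat.odd_iff, Nat.odd_mul,
      Nat.and_eq_zero_iff_mod_two_and_div_two, ← ih']
    rcases Nat.mod_two_eq_zero_or_one a with h | h <;>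
      rcases Nat.mod_two_eq_zero_or_one b with h' | h'
    · simp [h, h', show (a + b) % 2 = 0 by omega, show (a + b) / 2 = a / 2 + b / 2 by omega]
    · simp [h, h', show (a + b) % 2 = 1 by omega, show (a + b) / 2 = a / 2 + b / 2 by omega]
    · simp [h, h', show (a + b) % 2 = 1 by omega, show (a + b) / 2 = a / 2 + b / 2 by omega]
    · simp [h, h', show (a + b) % 2 = 0 by omega]

theorem Nat.add_add_eq_add_or_add_iff (a b c : ℕ) :
    a + b + c = (b + c) ||| (a + c) ↔ a &&& (b + c) = 0 ∧ b &&& c = 0 := by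
  induction h : a + b + c using Nat.strong_induction_on generalizing a b c with
  | _ n ih =>
    subst h
    rcases Nat.eq_zero_or_pos (a + b + c) with h0 | hpos
    · obtain ⟨⟨rfl, rfl⟩, rfl⟩ : (a = 0 ∧ b = 0) ∧ c = 0 := by omega
      simp
    have ih' := ih _ (by omega) (a / 2) (b / 2) (c / 2) rfl
    have hdiv : ((b + c) ||| (a + c)) / 2 = (b + c) / 2 ||| (a + c) / 2 := Nat.or_div_two
    have hmod : ((b + c) ||| (a + c)) % 2 = 1 ↔ (b + c) % 2 = 1 ∨ (a + c) % 2 = 1 :=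
      Nat.or_mod_two_eq_one
    rw [Nat.and_eq_zero_iff_mod_two_and_div_two a, Nat.and_eq_zero_iff_mod_two_and_div_two b]
    by_cases hcarry : a % 2 + b % 2 + c % 2 ≤ 1
    · rw [show (b + c) / 2 = b / 2 + c / 2 by omega] at hdiv ⊢
      rw [show (a + c) / 2 = a / 2 + c / 2 by omega] at hdiv
      omega
    · omega

theorem Nat.factorial_div_eq_choose_mul_choose (a b c : ℕ) :
    (a + b + c).factorial / (a.factorial * b.factorial * c.factorial) =
      (a + (b + c)).choose a * (b + c).choose b := by
  have h₁ := Nat.add_choose_mul_factorial_mul_factorial a (b + c)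
  have h₂ := Nat.add_choose_mul_factorial_mul_factorial b c
  refine Nat.div_eq_of_eq_mul_left (by positivity) ?_
  rw [add_assoc, ← h₁, ← h₂, Nat.choose_symm_add, Nat.choose_symm_add]
  ring

/-- For `max(s,t) ≤ d ≤ s + t`, the multinomial coefficient
`C^d_{d−s,d−t} = d!/((d−s)!·(d−t)!·(s+t−d)!)` is odd iff `d = s ∨ t`
(bitwise or). -/
theorem multinomial_odd_iff_lor (s t d : ℕ) (h1 : max s t ≤ d) (h2 : d ≤ s + t) :
    Odd (Nat.factorial d /
      (Nat.factorial (d - s) * Nat.factorial (d - t) * Nat.factorial (s + t - d))) ↔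
    d = s ||| t := by
  obtain ⟨hs, ht⟩ := max_le_iff.mp h1
  have key := Nat.add_add_eq_add_or_add_iff (d - s) (d - t) (s + t - d)
  have hfac := Nat.factorial_div_eq_choose_mul_choose (d - s) (d - t) (s + t - d)
  rw [show d - s + (d - t) + (s + t - d) = d by omega] at key hfac
  rw [hfac, Nat.odd_mul, Nat.odd_choose_add_iff_and_eq_zero,
    Nat.odd_choose_add_iff_and_eq_zero, ← key,
    show d - t + (s + t - d) = s by omega, show d - s + (s + t - d) = t by omega]
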